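/- arXiv:2007.10803 — 2 statements merged into one kernel-verified Lean document; each statement's English description precedes it below -/
import Mathlib

section
/- Let μ > 0 and ρ > 0. Then for every fixed x ∈ ℝ, the function s ↦ G(x,s;μ,ρ) is strictly concave on ℝ, and for every fixed s ∈ ℝ, the function x ↦ G(x,s;μ,ρ) is strictly convex on ℝ. -/
noncomputable def zfun (x s μ ρ : ℝ) : ℝ :=
  (1 / (2 * ρ)) * (Real.sqrt ((s - ρ * x) ^ 2 + 4 * ρ * μ) - (s - ρ * x))

noncomputable def yfun (x s μ ρ : ℝ) : ℝ :=
  (1 / (2 * ρ)) * (Real.sqrt ((s - ρ * x) ^ 2 + 4 * ρ * μ) + (s - ρ * x))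

noncomputable def Gfun (x s μ ρ : ℝ) : ℝ :=
  -μ * Real.log (zfun x s μ ρ) + s * (zfun x s μ ρ - x) + (ρ / 2) * (zfun x s μ ρ - x) ^ 2

theorem zfun_pos {μ ρ : ℝ} (hμ : 0 < μ) (hρ : 0 < ρ) (x s : ℝ) : 0 < zfun x s μ ρ := by
  have h : s - ρ * x < √((s - ρ * x) ^ 2 + 4 * ρ * μ) :=
    Real.lt_sqrt_of_sq_lt (by linarith [mul_pos hρ hμ])
  exact mul_pos (by positivity) (by linarith)

/-- First-order optimality condition of `zfun` for the augmented Lagrangian. -/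
theorem zfun_mul_eq {μ ρ : ℝ} (hμ : 0 < μ) (hρ : 0 < ρ) (x s : ℝ) :
    zfun x s μ ρ * (s + ρ * (zfun x s μ ρ - x)) = μ := by
  have h := Real.sq_sqrt (show 0 ≤ (s - ρ * x) ^ 2 + 4 * ρ * μ by positivity)
  unfold zfun
  generalize √((s - ρ * x) ^ 2 + 4 * ρ * μ) = r at *
  field_simp
  linear_combination h

theorem zfun_left_injective {μ ρ : ℝ} (hμ : 0 < μ) (hρ : 0 < ρ) (s : ℝ) :
    Function.Injective (fun x => zfun x s μ ρ) := by
  intro x y (h : zfun x s μ ρ = zfun y s μ ρ)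
  have hx := zfun_mul_eq hμ hρ x s
  rw [h] at hx
  have h' := mul_left_cancel₀ (zfun_pos hμ hρ y s).ne' (hx.trans (zfun_mul_eq hμ hρ y s).symm)
  exact mul_left_cancel₀ hρ.ne' (by linarith)

theorem zfun_right_injective {μ ρ : ℝ} (hμ : 0 < μ) (hρ : 0 < ρ) (x : ℝ) :
    Function.Injective (fun s => zfun x s μ ρ) := by
  intro s t (h : zfun x s μ ρ = zfun x t μ ρ)
  have hs := zfun_mul_eq hμ hρ x s
  rw [h] at hs
  have h' := mul_left_cancel₀ (zfun_pos hμ hρ x t).ne' (hs.trans (zfun_mul_eq hμ hρ x t).symm)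
  linarith

/-- `zfun` is the minimizer over the positive reals whose value is `Gfun`. -/
theorem Gfun_le {μ ρ : ℝ} (hμ : 0 < μ) (hρ : 0 < ρ) (x s : ℝ) {w : ℝ} (hw : 0 < w) :
    Gfun x s μ ρ + ρ / 2 * (w - zfun x s μ ρ) ^ 2 ≤
      -μ * Real.log w + s * (w - x) + ρ / 2 * (w - x) ^ 2 := by
  have hz := zfun_pos hμ hρ x s
  have he := zfun_mul_eq hμ hρ x s
  unfold Gfun
  generalize zfun x s μ ρ = z at *
  have hl := Real.log_le_sub_one_of_pos (div_pos hw hz)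
  rw [Real.log_div hw.ne' hz.ne'] at hl
  have hm := mul_le_mul_of_nonneg_left hl hμ.le
  have hq : μ * (w / z - 1) = (s + ρ * (z - x)) * (w - z) := by
    rw [← he]
    field_simp
  rw [hq] at hm
  linarith

theorem strictConcaveOn_Gfun {μ ρ : ℝ} (hμ : 0 < μ) (hρ : 0 < ρ) (x : ℝ) :
    StrictConcaveOn ℝ Set.univ (fun s => Gfun x s μ ρ) := by
  refine ⟨convex_univ, fun s _ t _ hst a b ha hb hab => ?_⟩
  simp only [smul_eq_mul]
  have hw := zfun_pos hμ hρ x (a * s + b * t)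
  have hG : Gfun x (a * s + b * t) μ ρ = -μ * Real.log (zfun x (a * s + b * t) μ ρ) +
      (a * s + b * t) * (zfun x (a * s + b * t) μ ρ - x) +
      ρ / 2 * (zfun x (a * s + b * t) μ ρ - x) ^ 2 := rfl
  rw [hG]
  generalize zfun x (a * s + b * t) μ ρ = w at *
  have h₁ := mul_le_mul_of_nonneg_left (Gfun_le hμ hρ x s hw) ha.le
  have h₂ := mul_le_mul_of_nonneg_left (Gfun_le hμ hρ x t hw) hb.le
  have hne : zfun x s μ ρ ≠ zfun x t μ ρ := (zfun_right_injective hμ hρ x).ne hst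
  have hpos : 0 < a * (ρ / 2 * (w - zfun x s μ ρ) ^ 2) + b * (ρ / 2 * (w - zfun x t μ ρ) ^ 2) := by
    by_cases h : w = zfun x s μ ρ
    · have : 0 < (w - zfun x t μ ρ) ^ 2 := sq_pos_of_ne_zero (sub_ne_zero.2 (h ▸ hne))
      positivity
    · have : 0 < (w - zfun x s μ ρ) ^ 2 := sq_pos_of_ne_zero (sub_ne_zero.2 h)
      positivity
  obtain rfl : b = 1 - a := by linarith
  linarith

theorem strictConvexOn_Gfun {μ ρ : ℝ} (hμ : 0 < μ) (hρ : 0 < ρ) (s : ℝ) :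
    StrictConvexOn ℝ Set.univ (fun x => Gfun x s μ ρ) := by
  refine ⟨convex_univ, fun x _ y _ hxy a b ha hb hab => ?_⟩
  simp only [smul_eq_mul]
  have hu := zfun_pos hμ hρ x s
  have hv := zfun_pos hμ hρ y s
  have hne : zfun x s μ ρ ≠ zfun y s μ ρ := (zfun_left_injective hμ hρ s).ne hxy
  have hw : 0 < a * zfun x s μ ρ + b * zfun y s μ ρ := by positivity
  have hG := Gfun_le hμ hρ (a * x + b * y) s hw
  have hsq : 0 ≤ ρ / 2 *
      (a * zfun x s μ ρ + b * zfun y s μ ρ - zfun (a * x + b * y) s μ ρ) ^ 2 := by positivity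
  have hlog := strictConcaveOn_log_Ioi.2 hu hv hne ha hb hab
  simp only [smul_eq_mul] at hlog
  have hμlog := mul_lt_mul_of_pos_left hlog hμ
  refine lt_of_le_of_lt (by linarith only [hG, hsq]) (?_ :
    -μ * Real.log (a * zfun x s μ ρ + b * zfun y s μ ρ) +
      s * (a * zfun x s μ ρ + b * zfun y s μ ρ - (a * x + b * y)) +
      ρ / 2 * (a * zfun x s μ ρ + b * zfun y s μ ρ - (a * x + b * y)) ^ 2 < _)
  unfold Gfun
  generalize zfun x s μ ρ = u at *
  generalize zfun y s μ ρ = v at *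
  have hquad : 0 ≤ ρ / 2 * (a * b * ((u - x) - (v - y)) ^ 2) := by positivity
  obtain rfl : b = 1 - a := by linarith
  linarith

theorem stmt_11 (μ ρ : ℝ) (hμ : 0 < μ) (hρ : 0 < ρ) :
    (∀ x : ℝ, StrictConcaveOn ℝ Set.univ (fun s => Gfun x s μ ρ)) ∧
    (∀ s : ℝ, StrictConvexOn ℝ Set.univ (fun x => Gfun x s μ ρ)) := by
  exact ⟨strictConcaveOn_Gfun hμ hρ, strictConvexOn_Gfun hμ hρ⟩
end

section
/- Let n, m ∈ ℕ, μ > 0, ρ > 0, and let f : ℝⁿ → ℝ and h : ℝⁿ → ℝᵐ be twice continuously differentiable. Fix w = (x,λ,s) ∈ ℝⁿ×ℝᵐ×ℝⁿ and write, for j = 1,…,n, z_j = z(x_j,s_j;μ,ρ) and y_j = y(x_j,s_j;μ,ρ); set r_d = ∇f(x) − Σ_{i=1}^m λ_i ∇h_i(x) − s ∈ ℝⁿ, r_h = h(x) ∈ ℝᵐ, r_e = (z_j − x_j)_{j=1}^n ∈ ℝⁿ, and φ_{(μ,ρ)}(w) = ½‖r_d‖² + ½‖r_h‖² + ½‖r_e‖².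 Let B ∈ ℝ^{n×n} be the Hessian at x of the Lagrangian x ↦ f(x) − λᵀh(x), and let A = ∇h(x) be the n×m matrix whose columns are ∇h_1(x),…,∇h_m(x). Suppose Δμ ∈ ℝ and (d_x, d_λ, d_s) ∈ ℝⁿ×ℝᵐ×ℝⁿ satisfy the Newton system: B·d_x − A·d_λ − d_s = −r_d; Aᵀ·d_x = −r_h; and, for every j, (y_j/(z_j+y_j))·(d_x)_j + (1/ρ)·(z_j/(z_j+y_j))·(d_s)_j = (z_j − x_j) + (1/ρ)·Δμ/(z_j+y_j). Then the function (μ,x,λ,s) ↦ φ_{(μ,ρ)}(x,λ,s) is differentiable at (μ,w) and its directional derivative at (μ,w) along the direction (Δμ, d_x, d_λ, d_s) equals −2·φ_{(μ,ρ)}(w). -/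
/-- The merit (residual) function φ_{(μ,ρ)}(x,λ,s), with gradients expressed
through Fréchet derivatives in the coordinate directions. -/
noncomputable def phiFun {n m : ℕ} (f : (Fin n → ℝ) → ℝ)
    (h : (Fin n → ℝ) → (Fin m → ℝ)) (μ ρ : ℝ)
    (x : Fin n → ℝ) (lam : Fin m → ℝ) (s : Fin n → ℝ) : ℝ :=
  (1 / 2) * (∑ j, (fderiv ℝ f x (Pi.single j 1)
      - (∑ i, lam i * fderiv ℝ h x (Pi.single j 1) i) - s j) ^ 2)
  + (1 / 2) * (∑ i, (h x i) ^ 2)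
  + (1 / 2) * (∑ j, (zfun (x j) (s j) μ ρ - x j) ^ 2)

/-- φ viewed as a function of the joint variable (μ, x, λ, s). -/
noncomputable def PhiBig {n m : ℕ} (f : (Fin n → ℝ) → ℝ)
    (h : (Fin n → ℝ) → (Fin m → ℝ)) (ρ : ℝ) :
    ℝ × (Fin n → ℝ) × (Fin m → ℝ) × (Fin n → ℝ) → ℝ :=
  fun p => phiFun f h p.1 ρ p.2.1 p.2.2.1 p.2.2.2

/-- If every residual is differentiable and a direction `v` sends each residual `r i` to `-r i`
to first order, then half the sum of squares decreases along `v` at twice its value. -/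
theorem hasFDerivAt_half_sum_sq {E ι : Type*} [NormedAddCommGroup E] [NormedSpace ℝ E] [Fintype ι]
    {r : ι → E → ℝ} {p v : E}
    (hr : ∀ i, ∃ r' : E →L[ℝ] ℝ, HasFDerivAt (r i) r' p ∧ r' v = -r i p) :
    ∃ F' : E →L[ℝ] ℝ, HasFDerivAt (fun q => (1 / 2 : ℝ) * ∑ i, r i q ^ 2) F' p ∧
      F' v = -2 * ((1 / 2 : ℝ) * ∑ i, r i p ^ 2) := by
  choose r' hd hv using hr
  refine ⟨_, (HasFDerivAt.fun_sum fun i _ => (hd i).pow 2).const_mul (1 / 2 : ℝ), ?_⟩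
  simp only [smul_apply, sum_apply, smul_eq_mul, hv,
    Finset.mul_sum]
  refine Finset.sum_congr rfl fun i _ => ?_
  norm_num
  ring

theorem zfun_add_yfun {ρ : ℝ} (hρ : ρ ≠ 0) (x s μ : ℝ) :
    zfun x s μ ρ + yfun x s μ ρ = √((s - ρ * x) ^ 2 + 4 * ρ * μ) / ρ := by
  unfold zfun yfun
  field_simp
  ring

/-- The derivative of `zfun` in the variables `(x, s, μ)`, in terms of `zfun` and `yfun`. -/
theorem hasFDerivAt_zfun {E : Type*} [NormedAddCommGroup E] [NormedSpace ℝ E] {p : E}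
    {X S M : E → ℝ} {X' S' M' : E →L[ℝ] ℝ} {ρ : ℝ} (hρ : 0 < ρ) (hM : 0 < M p)
    (hX' : HasFDerivAt X X' p) (hS' : HasFDerivAt S S' p) (hM' : HasFDerivAt M M' p) :
    ∃ Z' : E →L[ℝ] ℝ, HasFDerivAt (fun q => zfun (X q) (S q) (M q) ρ) Z' p ∧
      ∀ v, Z' v - X' v = 1 / ρ * M' v / (zfun (X p) (S p) (M p) ρ + yfun (X p) (S p) (M p) ρ)
        - (yfun (X p) (S p) (M p) ρ /
            (zfun (X p) (S p) (M p) ρ + yfun (X p) (S p) (M p) ρ) * X' v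
          + 1 / ρ * (zfun (X p) (S p) (M p) ρ /
            (zfun (X p) (S p) (M p) ρ + yfun (X p) (S p) (M p) ρ)) * S' v) := by
  have hpos : 0 < (S p - ρ * X p) ^ 2 + 4 * ρ * M p := by positivity
  have hD := hS'.sub (hX'.const_mul ρ)
  refine ⟨_, ((((hD.pow 2).add (hM'.const_mul (4 * ρ))).sqrt hpos.ne').sub hD).const_mul
    (1 / (2 * ρ)), fun v => ?_⟩
  rw [zfun_add_yfun hρ.ne']
  have hR := Real.sqrt_pos.2 hpos
  simp only [zfun, yfun]
  simp
  generalize √((S p - ρ * X p) ^ 2 + 4 * ρ * M p) = R at hR ⊢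
  field_simp
  ring

/-- The Hessian matrix of a `C²` function acts on `d` as the derivative along `d` of the
gradient. -/
theorem sum_hessian_mul {n : ℕ} {L : (Fin n → ℝ) → ℝ} (hL : ContDiff ℝ 2 L)
    (x d : Fin n → ℝ) (j : Fin n) :
    ∑ j', fderiv ℝ (fun t => fderiv ℝ L t (Pi.single j' 1)) x (Pi.single j 1) * d j' =
      fderiv ℝ (fun t => fderiv ℝ L t (Pi.single j 1)) x d := by
  have hd : DifferentiableAt ℝ (fderiv ℝ L) x :=
    (hL.fderiv_right (m := 1) (by norm_num)).differentiable one_ne_zero x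
  have happ (u v : Fin n → ℝ) :
      fderiv ℝ (fun t => fderiv ℝ L t u) x v = fderiv ℝ (fderiv ℝ L) x v u := by
    rw [fderiv_clm_apply hd (differentiableAt_const u)]
    simp
  have hsymm : IsSymmSndFDerivAt ℝ L x := hL.contDiffAt.isSymmSndFDerivAt (by simp)
  simp only [happ]
  rw [hsymm.eq d]
  conv_rhs => rw [pi_eq_sum_univ' d]
  simp [map_sum, mul_comm]

/-- The derivative of a component of the gradient of a Lagrangian, jointly in the primal and
dual variables. -/
theorem hasFDerivAt_dual_residual {n m : ℕ} {f : (Fin n → ℝ) → ℝ}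
    {h : (Fin n → ℝ) → (Fin m → ℝ)} (hf : ContDiff ℝ 2 f) (hh : ContDiff ℝ 2 h)
    (p : ℝ × (Fin n → ℝ) × (Fin m → ℝ) × (Fin n → ℝ)) (j : Fin n) :
    ∃ r' : ℝ × (Fin n → ℝ) × (Fin m → ℝ) × (Fin n → ℝ) →L[ℝ] ℝ,
      HasFDerivAt (fun q : ℝ × (Fin n → ℝ) × (Fin m → ℝ) × (Fin n → ℝ) =>
        fderiv ℝ f q.2.1 (Pi.single j 1)
          - (∑ i, q.2.2.1 i * fderiv ℝ h q.2.1 (Pi.single j 1) i) - q.2.2.2 j) r' p ∧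
      ∀ v, r' v =
        fderiv ℝ (fun t => fderiv ℝ (fun u => f u - ∑ i, p.2.2.1 i * h u i) t
          (Pi.single j 1)) p.2.1 v.2.1
        - (∑ i, fderiv ℝ h p.2.1 (Pi.single j 1) i * v.2.2.1 i) - v.2.2.2 j := by
  obtain ⟨μ, x, lam, s⟩ := p
  have hgrad : (fun t => fderiv ℝ (fun u => f u - ∑ i, lam i * h u i) t (Pi.single j 1)) =
      fun t => fderiv ℝ f t (Pi.single j 1)
        - ∑ i, lam i * fderiv ℝ h t (Pi.single j 1) i := by
    funext t
    have hht := (hh.differentiable two_ne_zero t).hasFDerivAt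
    rw [((hf.differentiable two_ne_zero t).hasFDerivAt.fun_sub
      (HasFDerivAt.fun_sum fun i _ => (hasFDerivAt_pi'.1 hht i).const_mul (lam i))).fderiv]
    simp
  have hfd : HasFDerivAt (fun t => fderiv ℝ f t (Pi.single j 1)) _ x :=
    (((hf.fderiv_right (m := 1) (by norm_num)).clm_apply
      contDiff_const).differentiable one_ne_zero x).hasFDerivAt
  have hhd : HasFDerivAt (fun t => fderiv ℝ h t (Pi.single j 1)) _ x :=
    (((hh.fderiv_right (m := 1) (by norm_num)).clm_apply
      contDiff_const).differentiable one_ne_zero x).hasFDerivAt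
  have hhi (i : Fin m) := hasFDerivAt_pi'.1 hhd i
  have hx : HasFDerivAt (fun q : ℝ × (Fin n → ℝ) × (Fin m → ℝ) × (Fin n → ℝ) => q.2.1)
      (ContinuousLinearMap.fst ℝ _ _ ∘L ContinuousLinearMap.snd ℝ _ _) (μ, x, lam, s) :=
    HasFDerivAt.comp _ hasFDerivAt_fst hasFDerivAt_snd
  have hlam : HasFDerivAt (fun q : ℝ × (Fin n → ℝ) × (Fin m → ℝ) × (Fin n → ℝ) => q.2.2.1)
      (ContinuousLinearMap.fst ℝ _ _ ∘L ContinuousLinearMap.snd ℝ _ _ ∘L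
        ContinuousLinearMap.snd ℝ _ _) (μ, x, lam, s) :=
    HasFDerivAt.comp _ hasFDerivAt_fst (HasFDerivAt.comp _ hasFDerivAt_snd hasFDerivAt_snd)
  have hs : HasFDerivAt (fun q : ℝ × (Fin n → ℝ) × (Fin m → ℝ) × (Fin n → ℝ) => q.2.2.2)
      (ContinuousLinearMap.snd ℝ _ _ ∘L ContinuousLinearMap.snd ℝ _ _ ∘L
        ContinuousLinearMap.snd ℝ _ _) (μ, x, lam, s) :=
    HasFDerivAt.comp _ hasFDerivAt_snd (HasFDerivAt.comp _ hasFDerivAt_snd hasFDerivAt_snd)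
  have hfx := HasFDerivAt.comp (μ, x, lam, s) hfd hx
  have hhx (i : Fin m) := HasFDerivAt.comp (μ, x, lam, s) (hhi i) hx
  refine ⟨_, (hfx.fun_sub (HasFDerivAt.fun_sum fun i _ =>
    (hasFDerivAt_pi'.1 hlam i).fun_mul (hhx i))).fun_sub (hasFDerivAt_pi'.1 hs j), fun v => ?_⟩
  rw [hgrad, (hfd.fun_sub (HasFDerivAt.fun_sum fun i _ => (hhi i).const_mul (lam i))).fderiv]
  simp [Finset.sum_add_distrib]
  ring

theorem stmt_18 (n m : ℕ) (μ ρ : ℝ) (hμ : 0 < μ) (hρ : 0 < ρ)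
    (f : (Fin n → ℝ) → ℝ) (h : (Fin n → ℝ) → (Fin m → ℝ))
    (hf : ContDiff ℝ 2 f) (hh : ContDiff ℝ 2 h)
    (x : Fin n → ℝ) (lam : Fin m → ℝ) (s : Fin n → ℝ)
    (B : Matrix (Fin n) (Fin n) ℝ) (A : Matrix (Fin n) (Fin m) ℝ)
    -- B is the Hessian at x of the Lagrangian x ↦ f(x) − λᵀ h(x)
    (hB : ∀ j j' : Fin n, B j j' =
      fderiv ℝ (fun t => fderiv ℝ (fun u => f u - ∑ i, lam i * h u i) t
        (Pi.single j' 1)) x (Pi.single j 1))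
    -- the columns of A are the gradients ∇h₁(x),…,∇h_m(x)
    (hA : ∀ (j : Fin n) (i : Fin m), A j i = fderiv ℝ h x (Pi.single j 1) i)
    (Δμ : ℝ) (dx : Fin n → ℝ) (dlam : Fin m → ℝ) (ds : Fin n → ℝ)
    -- the Newton system
    (hN1 : ∀ j, B.mulVec dx j - A.mulVec dlam j - ds j =
      -(fderiv ℝ f x (Pi.single j 1) - (∑ i, lam i * A j i) - s j))
    (hN2 : ∀ i, (∑ j, A j i * dx j) = -(h x i))
    (hN3 : ∀ j,
      (yfun (x j) (s j) μ ρ / (zfun (x j) (s j) μ ρ + yfun (x j) (s j) μ ρ)) * dx j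
        + (1 / ρ) * (zfun (x j) (s j) μ ρ / (zfun (x j) (s j) μ ρ + yfun (x j) (s j) μ ρ)) * ds j
      = (zfun (x j) (s j) μ ρ - x j)
        + (1 / ρ) * Δμ / (zfun (x j) (s j) μ ρ + yfun (x j) (s j) μ ρ)) :
    DifferentiableAt ℝ (PhiBig f h ρ) (μ, x, lam, s) ∧
    fderiv ℝ (PhiBig f h ρ) (μ, x, lam, s) (Δμ, dx, dlam, ds)
      = -2 * phiFun f h μ ρ x lam s := by
  have hL : ContDiff ℝ 2 fun u => f u - ∑ i, lam i * h u i :=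
    hf.sub (ContDiff.sum fun i _ => contDiff_const.mul (contDiff_pi.1 hh i))
  have hx : HasFDerivAt (fun q : ℝ × (Fin n → ℝ) × (Fin m → ℝ) × (Fin n → ℝ) => q.2.1)
      (ContinuousLinearMap.fst ℝ _ _ ∘L ContinuousLinearMap.snd ℝ _ _) (μ, x, lam, s) :=
    HasFDerivAt.comp _ hasFDerivAt_fst hasFDerivAt_snd
  have hs : HasFDerivAt (fun q : ℝ × (Fin n → ℝ) × (Fin m → ℝ) × (Fin n → ℝ) => q.2.2.2)
      (ContinuousLinearMap.snd ℝ _ _ ∘L ContinuousLinearMap.snd ℝ _ _ ∘L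
        ContinuousLinearMap.snd ℝ _ _) (μ, x, lam, s) :=
    HasFDerivAt.comp _ hasFDerivAt_snd (HasFDerivAt.comp _ hasFDerivAt_snd hasFDerivAt_snd)
  obtain ⟨D', hD', hDv⟩ := hasFDerivAt_half_sum_sq (p := (μ, x, lam, s)) (v := (Δμ, dx, dlam, ds))
    (r := fun j q => fderiv ℝ f q.2.1 (Pi.single j 1)
      - (∑ i, q.2.2.1 i * fderiv ℝ h q.2.1 (Pi.single j 1) i) - q.2.2.2 j) fun j => by
    obtain ⟨r', hr', hv⟩ := hasFDerivAt_dual_residual hf hh (μ, x, lam, s) j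
    refine ⟨r', hr', ?_⟩
    have hN := hN1 j
    simp only [Matrix.mulVec, dotProduct, hA, hB, sum_hessian_mul hL] at hN
    rw [hv]
    exact hN
  obtain ⟨H', hH', hHv⟩ := hasFDerivAt_half_sum_sq (p := (μ, x, lam, s)) (v := (Δμ, dx, dlam, ds))
    (r := fun i q => h q.2.1 i) fun i => by
    have hhi := hasFDerivAt_pi'.1 (hh.differentiable two_ne_zero x).hasFDerivAt i
    have hhx := HasFDerivAt.comp (μ, x, lam, s) hhi hx
    refine ⟨_, hhx, ?_⟩
    have hN := hN2 i
    simp only [hA] at hN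
    rw [← hN]
    conv_lhs => simp
    conv_lhs => rw [pi_eq_sum_univ' dx]
    simp [map_sum, mul_comm]
  obtain ⟨E', hE', hEv⟩ := hasFDerivAt_half_sum_sq (p := (μ, x, lam, s)) (v := (Δμ, dx, dlam, ds))
    (r := fun j q => zfun (q.2.1 j) (q.2.2.2 j) q.1 ρ - q.2.1 j) fun j => by
    obtain ⟨Z', hZ', hv⟩ := hasFDerivAt_zfun (p := (μ, x, lam, s)) hρ hμ
      (hasFDerivAt_pi'.1 hx j) (hasFDerivAt_pi'.1 hs j) hasFDerivAt_fst
    refine ⟨_, hZ'.sub (hasFDerivAt_pi'.1 hx j), ?_⟩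
    rw [sub_apply, hv]
    have hN := hN3 j
    simp
    simp at hN
    linarith
  have hΦ : HasFDerivAt (PhiBig f h ρ) (D' + H' + E') (μ, x, lam, s) := (hD'.add hH').add hE'
  refine ⟨hΦ.differentiableAt, ?_⟩
  rw [hΦ.fderiv, add_apply, add_apply, hDv, hHv, hEv,
    phiFun]
  ring
end
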